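/- arXiv:1611.03667 — 4 statements merged into one kernel-verified Lean document; each statement's English description precedes it below -/
import Mathlib

section
/- Every maximal ideal of the ring C^ω[0,1] is of the form M^ω_γ for some γ ∈ [0,1]; that is, for any maximal ideal M of C^ω[0,1] there exists γ ∈ [0,1] such that M = {f ∈ C^ω[0,1] : f(γ) = 0}. -/
/-- Extension of a function on `[0,1]` to `ℝ` by zero. -/
noncomputable def extIcc (f : Set.Icc (0:ℝ) 1 → ℝ) : ℝ → ℝ :=
  fun y => if h : y ∈ Set.Icc (0:ℝ) 1 then f ⟨y, h⟩ else 0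

lemma extIcc_eq (f : Set.Icc (0:ℝ) 1 → ℝ) {y : ℝ} (h : y ∈ Set.Icc (0:ℝ) 1) :
    extIcc f y = f ⟨y, h⟩ := dif_pos h

/-- A function on `[0,1]` is real analytic on `[0,1]` if at every point of `[0,1]` it is given
by a convergent power series on a neighborhood within `[0,1]` (one-sided at endpoints). -/
def IsAnalyticOnIcc (f : Set.Icc (0:ℝ) 1 → ℝ) : Prop :=
  ∀ x : Set.Icc (0:ℝ) 1, AnalyticWithinAt ℝ (extIcc f) (Set.Icc (0:ℝ) 1) x

lemma extIcc_add (f g : Set.Icc (0:ℝ) 1 → ℝ) : extIcc (f + g) = extIcc f + extIcc g := by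
  funext y; by_cases h : y ∈ Set.Icc (0:ℝ) 1 <;> simp [extIcc, h]

lemma extIcc_mul (f g : Set.Icc (0:ℝ) 1 → ℝ) : extIcc (f * g) = extIcc f * extIcc g := by
  funext y; by_cases h : y ∈ Set.Icc (0:ℝ) 1 <;> simp [extIcc, h]

lemma extIcc_neg (f : Set.Icc (0:ℝ) 1 → ℝ) : extIcc (-f) = -extIcc f := by
  funext y; by_cases h : y ∈ Set.Icc (0:ℝ) 1 <;> simp [extIcc, h]

/-- The ring `C^ω[0,1]` of real analytic functions on `[0,1]`, as a subring of the ring of all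
functions `[0,1] → ℝ` with pointwise operations. -/
noncomputable def Comega : Subring (Set.Icc (0:ℝ) 1 → ℝ) where
  carrier := {f | IsAnalyticOnIcc f}
  zero_mem' := by
    intro x
    apply (analyticWithinAt_const (v := (0:ℝ))).congr
    · intro y hy; simp [extIcc, hy]
    · simp [extIcc, x.2]
  one_mem' := by
    intro x
    apply (analyticWithinAt_const (v := (1:ℝ))).congr
    · intro y hy; simp [extIcc, hy]
    · simp [extIcc, x.2]
  add_mem' hf hg x := by rw [extIcc_add]; exact (hf x).add (hg x)
  mul_mem' hf hg x := by rw [extIcc_mul]; exact (hf x).mul (hg x)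
  neg_mem' hf x := by rw [extIcc_neg]; exact (hf x).neg

/-- The ideal `M^ω_γ = {f ∈ C^ω[0,1] : f(γ) = 0}` of `C^ω[0,1]`. -/
noncomputable def Momega (γ : Set.Icc (0:ℝ) 1) : Ideal Comega where
  carrier := {f | (f : Set.Icc (0:ℝ) 1 → ℝ) γ = 0}
  zero_mem' := rfl
  add_mem' := by
    intro a b ha hb
    simp only [Set.mem_setOf_eq] at *
    simp [ha, hb]
  smul_mem' := by
    intro c f hf
    simp only [Set.mem_setOf_eq, smul_eq_mul] at *
    simp [hf]

lemma IsAnalyticOnIcc.continuous {f : Set.Icc (0:ℝ) 1 → ℝ} (hf : IsAnalyticOnIcc f) :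
    Continuous f := by
  have h : ContinuousOn (extIcc f) (Set.Icc (0:ℝ) 1) :=
    fun x hx => (hf ⟨x, hx⟩).continuousWithinAt
  have heq : f = (Set.Icc (0:ℝ) 1).domRestrict (extIcc f) := by
    funext x
    exact (extIcc_eq f x.2).symm
  rw [heq]
  exact h.domRestrict

lemma IsAnalyticOnIcc.inv {f : Set.Icc (0:ℝ) 1 → ℝ} (hf : IsAnalyticOnIcc f)
    (h0 : ∀ x, f x ≠ 0) : IsAnalyticOnIcc f⁻¹ := by
  intro x
  have hx : extIcc f x ≠ 0 := by
    rw [extIcc_eq f x.2]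
    exact h0 x
  have heq : extIcc f⁻¹ = (extIcc f)⁻¹ := by
    funext y
    by_cases h : y ∈ Set.Icc (0:ℝ) 1 <;> simp [extIcc, h]
  rw [heq]
  exact (hf x).inv hx

lemma Comega.isUnit_of_forall_ne_zero (f : Comega)
    (h0 : ∀ x, (f : Set.Icc (0:ℝ) 1 → ℝ) x ≠ 0) : IsUnit f := by
  refine IsUnit.of_mul_eq_one (⟨_, IsAnalyticOnIcc.inv f.2 h0⟩ : Comega) ?_
  ext x
  exact mul_inv_cancel₀ (h0 x)

lemma Momega_ne_top (γ : Set.Icc (0:ℝ) 1) : Momega γ ≠ ⊤ := by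
  rw [Ideal.ne_top_iff_one]
  exact one_ne_zero (α := ℝ)

/-- An ideal of `C^ω[0,1]` whose elements have no common zero contains a positive function. -/
lemma exists_mem_forall_pos (I : Ideal Comega)
    (hI : ∀ γ, ∃ f ∈ I, (f : Set.Icc (0:ℝ) 1 → ℝ) γ ≠ 0) :
    ∃ g ∈ I, ∀ x, 0 < (g : Set.Icc (0:ℝ) 1 → ℝ) x := by
  suffices h : ∃ g ∈ I, (∀ x, 0 ≤ (g : Set.Icc (0:ℝ) 1 → ℝ) x) ∧
      ∀ x ∈ Set.univ, 0 < (g : Set.Icc (0:ℝ) 1 → ℝ) x by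
    obtain ⟨g, hg, -, hpos⟩ := h
    exact ⟨g, hg, fun x => hpos x trivial⟩
  refine isCompact_univ.induction_on
    (p := fun s => ∃ g ∈ I, (∀ x, 0 ≤ (g : Set.Icc (0:ℝ) 1 → ℝ) x) ∧
      ∀ x ∈ s, 0 < (g : Set.Icc (0:ℝ) 1 → ℝ) x) ?_ ?_ ?_ ?_
  · exact ⟨0, I.zero_mem, fun x => le_rfl, fun x hx => hx.elim⟩
  · rintro s t hst ⟨g, hg, hnonneg, hpos⟩
    exact ⟨g, hg, hnonneg, fun x hx => hpos x (hst hx)⟩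
  · rintro s t ⟨g, hg, hg0, hgs⟩ ⟨k, hk, hk0, hkt⟩
    refine ⟨g + k, I.add_mem hg hk, fun x => add_nonneg (hg0 x) (hk0 x), ?_⟩
    rintro x (hx | hx)
    · exact add_pos_of_pos_of_nonneg (hgs x hx) (hk0 x)
    · exact add_pos_of_nonneg_of_pos (hg0 x) (hkt x hx)
  · intro γ _
    obtain ⟨f, hf, hfγ⟩ := hI γ
    have hcont : Continuous (f : Set.Icc (0:ℝ) 1 → ℝ) := IsAnalyticOnIcc.continuous f.2
    refine ⟨{x | (f : Set.Icc (0:ℝ) 1 → ℝ) x ≠ 0},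
      mem_nhdsWithin_of_mem_nhds (hcont.continuousAt.eventually_ne hfγ),
      f * f, I.mul_mem_left f hf, fun x => mul_self_nonneg _, fun x hx => mul_self_pos.2 hx⟩

/-- Every maximal ideal of C^ω[0,1] is of the form M^ω_γ for some γ ∈ [0,1]. -/
theorem maximal_ideal_eq_Momega (M : Ideal Comega) (hM : M.IsMaximal) :
    ∃ γ : Set.Icc (0:ℝ) 1, M = Momega γ := by
  suffices h : ∃ γ, M ≤ Momega γ by
    obtain ⟨γ, hγ⟩ := h
    exact ⟨γ, hM.eq_of_le (Momega_ne_top γ) hγ⟩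
  by_contra! hnot
  obtain ⟨g, hg, hpos⟩ := exists_mem_forall_pos M fun γ => Set.not_subset.1 (hnot γ)
  exact hM.ne_top (M.eq_top_of_isUnit_mem hg
    (Comega.isUnit_of_forall_ne_zero g fun x => (hpos x).ne'))
end

section
/- Every nonzero proper ideal I of the ring C^ω[0,1] is generated by a polynomial with all roots in [0,1]: there exist n ≥ 1 and points γ_1, …, γ_n ∈ [0,1] (not necessarily distinct) such that I = ⟨∏_{i=1}^{n} (x − γ_i)⟩, i.e. I is the principal ideal generated by the function x ↦ (x − γ_1)(x − γ_2)⋯(x − γ_n). -/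
/-- The function x ↦ x - γ as an element of C^ω[0,1]. -/
noncomputable def linShift (γ : Set.Icc (0:ℝ) 1) : Comega :=
  ⟨fun x => (x : ℝ) - (γ : ℝ), by
    intro x
    apply (analyticWithinAt_id.sub (analyticWithinAt_const (v := (γ:ℝ)))).congr
    · intro y hy; simp [extIcc, hy]
    · simp [extIcc, x.2]⟩

namespace Comega

open Filter Topology

/-- Every element of `C^ω[0,1]` extends to a function analytic on a neighborhood of `[0,1]`. -/
lemma exists_analyticOnNhd (f : Comega) :
    ∃ G : ℝ → ℝ, AnalyticOnNhd ℝ G (Set.Icc 0 1) ∧ ∀ x : Set.Icc (0:ℝ) 1, G x = f.1 x := by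
  have key : ∀ x : Set.Icc (0:ℝ) 1, ∃ g : ℝ → ℝ,
      Set.EqOn (extIcc f.1) g (Set.Icc 0 1) ∧ AnalyticAt ℝ g x := fun x => by
    obtain ⟨g, -, hg, ha⟩ := analyticWithinAt_iff_exists_analyticAt'.1 (f.2 x)
    exact ⟨g, hg.mono (Set.subset_insert _ _), ha⟩
  obtain ⟨g₀, hg₀, ha₀⟩ := key 0
  obtain ⟨g₁, hg₁, ha₁⟩ := key 1
  refine ⟨fun y => if y < 0 then g₀ y else if 1 < y then g₁ y else extIcc f.1 y, ?_, ?_⟩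
  · intro x hx
    rcases hx.1.eq_or_lt with rfl | h0
    · refine ha₀.congr ?_
      filter_upwards [Iio_mem_nhds (zero_lt_one' ℝ)] with y (hy : y < 1)
      by_cases h : y < 0
      · simp [h]
      · simpa [h, not_lt.2 hy.le] using (hg₀ ⟨not_lt.1 h, hy.le⟩).symm
    rcases hx.2.eq_or_lt with rfl | h1
    · refine ha₁.congr ?_
      filter_upwards [Ioi_mem_nhds (zero_lt_one' ℝ)] with y (hy : 0 < y)
      have hy' : ¬ y < 0 := not_lt.2 hy.le
      by_cases h : 1 < y
      · simp [h, hy']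
      · simpa [h, hy'] using (hg₁ ⟨hy.le, not_lt.1 h⟩).symm
    · obtain ⟨g, hg, ha⟩ := key ⟨x, hx⟩
      refine ha.congr ?_
      filter_upwards [Ioi_mem_nhds h0, Iio_mem_nhds h1] with y (hy0 : 0 < y) (hy1 : y < 1)
      simpa [not_lt.2 hy0.le, not_lt.2 hy1.le] using
        (hg ⟨hy0.le, hy1.le⟩).symm
  · intro x
    simp [not_lt.2 x.2.1, not_lt.2 x.2.2, extIcc_eq f.1 x.2]

/-- The restriction to `[0,1]` of a function analytic near `[0,1]`. -/
noncomputable def ofAnalyticOnNhd (G : ℝ → ℝ) (hG : AnalyticOnNhd ℝ G (Set.Icc 0 1)) : Comega :=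
  ⟨fun x => G x, fun x => ((hG x x.2).analyticWithinAt).congr
    (fun _ hy => extIcc_eq _ hy) (extIcc_eq _ x.2)⟩

lemma continuous_coe (f : Comega) : Continuous f.1 := by
  obtain ⟨G, hG, hGf⟩ := exists_analyticOnNhd f
  rw [show f.1 = fun x : Set.Icc (0:ℝ) 1 => G x from funext fun x => (hGf x).symm]
  exact hG.continuousOn.comp_continuous continuous_subtype_val fun x => x.2

lemma linShift_dvd_iff (γ : Set.Icc (0:ℝ) 1) (f : Comega) : linShift γ ∣ f ↔ f.1 γ = 0 := by
  constructor
  · rintro ⟨g, rfl⟩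
    simp [linShift]
  · intro hf
    obtain ⟨G, hG, hGf⟩ := exists_analyticOnNhd f
    have hD : AnalyticOnNhd ℝ (dslope G γ) (Set.Icc 0 1) := by
      intro x hx
      by_cases hxγ : x = γ
      · obtain ⟨p, hp⟩ := hG x hx
        rw [← hxγ]
        exact hp.has_fpower_series_dslope_fslope.analyticAt
      · have : AnalyticAt ℝ (fun y : ℝ => (y - (γ : ℝ))⁻¹ * (G y - G γ)) x :=
          ((analyticAt_id.sub analyticAt_const).inv (sub_ne_zero.2 hxγ)).mul
            ((hG x hx).sub analyticAt_const)
        refine this.congr ?_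
        filter_upwards [isOpen_ne.mem_nhds hxγ] with y hy
        rw [dslope_of_ne _ hy, slope_def_module, smul_eq_mul]
    refine ⟨ofAnalyticOnNhd _ hD, Subtype.ext (funext fun x => ?_)⟩
    have := sub_smul_dslope G γ x
    rw [hGf, hGf, hf, sub_zero, smul_eq_mul] at this
    exact this.symm

lemma isUnit_of_forall_ne_zero_s7 (f : Comega) (hf : ∀ x, f.1 x ≠ 0) : IsUnit f := by
  obtain ⟨G, hG, hGf⟩ := exists_analyticOnNhd f
  have hinv : AnalyticOnNhd ℝ G⁻¹ (Set.Icc 0 1) := fun x hx =>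
    (hG x hx).inv (by rw [hGf ⟨x, hx⟩]; exact hf _)
  refine IsUnit.of_mul_eq_one (ofAnalyticOnNhd _ hinv) (Subtype.ext (funext fun x => ?_))
  change f.1 x * (G x)⁻¹ = 1
  rw [hGf, mul_inv_cancel₀ (hf x)]

lemma finiteMultiplicity_linShift {f : Comega} (hf : f ≠ 0) (γ : Set.Icc (0:ℝ) 1) :
    FiniteMultiplicity (linShift γ) f := by
  obtain ⟨G, hG, hGf⟩ := exists_analyticOnNhd f
  obtain ⟨x, hx⟩ : ∃ x, f.1 x ≠ 0 := by
    by_contra! h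
    exact hf (Subtype.ext (funext h))
  have hord : analyticOrderAt G γ ≠ ⊤ := by
    refine hG.analyticOrderAt_ne_top_of_isPreconnected isPreconnected_Icc x.2 γ.2 ?_
    rw [(hG x x.2).analyticOrderAt_eq_zero.2 (by rwa [hGf])]
    exact ENat.zero_ne_top
  obtain ⟨n, hn⟩ := ENat.ne_top_iff_exists.1 hord
  refine FiniteMultiplicity.def.2 ⟨n, ?_⟩
  rintro ⟨h, hfh⟩
  obtain ⟨H, hH, hHh⟩ := exists_analyticOnNhd h
  have hpow : AnalyticAt ℝ (fun y : ℝ => (y - γ) ^ (n + 1) • H y) γ :=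
    ((analyticAt_id.sub analyticAt_const).pow _).smul (hH γ γ.2)
  have hacc : AccPt (γ : ℝ) (𝓟 (Set.Icc 0 1)) :=
    isPreconnected_Icc.preperfect_of_nontrivial
      ⟨0, by simp, 1, by simp, zero_ne_one⟩ _ γ.2
  have hfreq : ∃ᶠ y in 𝓝[≠] (γ : ℝ), G y = (y - γ) ^ (n + 1) • H y := by
    refine (accPt_iff_frequently_nhdsNE.1 hacc).mono fun y hy => ?_
    have := congrFun (congrArg Subtype.val hfh) ⟨y, hy⟩
    rw [← hGf] at this
    simpa [linShift, ← hHh] using this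
  have hev := ((hG γ γ.2).frequently_eq_iff_eventually_eq hpow).1 hfreq
  have hle : ((n + 1 : ℕ) : ℕ∞) ≤ analyticOrderAt G γ :=
    (natCast_le_analyticOrderAt (hG γ γ.2)).2 ⟨H, hH γ γ.2, hev⟩
  rw [← hn, Nat.cast_le] at hle
  omega

lemma apply_eq_zero_of_dvd {g f : Comega} (h : g ∣ f) {x : Set.Icc (0:ℝ) 1} (hg : g.1 x = 0) :
    f.1 x = 0 := by
  obtain ⟨k, rfl⟩ := h
  simp [hg]

/-- Every nonzero element of `C^ω[0,1]` is a unit times a product of linear factors. -/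
lemma exists_eq_unit_mul_prod_linShift {f : Comega} (hf : f ≠ 0) :
    ∃ (m : Multiset (Set.Icc (0:ℝ) 1)) (u : Comega), IsUnit u ∧ f = u * (m.map linShift).prod := by
  suffices H : ∀ g, g ∣ f → ∃ (m : Multiset (Set.Icc (0:ℝ) 1)) (u : Comega),
      g = u * (m.map linShift).prod ∧ ∀ x ∈ (Set.univ : Set (Set.Icc (0:ℝ) 1)), u.1 x ≠ 0 by
    obtain ⟨m, u, h, hu⟩ := H f dvd_rfl
    exact ⟨m, u, isUnit_of_forall_ne_zero_s7 u fun x => hu x trivial, h⟩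
  refine isCompact_univ.induction_on (p := fun S => ∀ g, g ∣ f →
    ∃ (m : Multiset (Set.Icc (0:ℝ) 1)) (u : Comega),
      g = u * (m.map linShift).prod ∧ ∀ x ∈ S, u.1 x ≠ 0) ?_ ?_ ?_ ?_
  · exact fun g _ => ⟨0, g, by simp, by simp⟩
  · intro S T hST hT g hg
    obtain ⟨m, u, h, hu⟩ := hT g hg
    exact ⟨m, u, h, fun x hx => hu x (hST hx)⟩
  · intro S T hS hT g hg
    obtain ⟨m, u, rfl, hu⟩ := hS g hg
    obtain ⟨m', u', rfl, hu'⟩ := hT u ((dvd_mul_right _ _).trans hg)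
    refine ⟨m' + m, u', by simp [mul_assoc], ?_⟩
    rintro x (hx | hx) h0
    · exact hu x hx (apply_eq_zero_of_dvd (dvd_mul_right _ _) h0)
    · exact hu' x hx h0
  · intro γ _
    have hfin := finiteMultiplicity_linShift hf γ
    obtain ⟨c, hc, hcγ⟩ := hfin.exists_eq_pow_mul_and_not_dvd
    rw [linShift_dvd_iff] at hcγ
    refine ⟨{x | c.1 x ≠ 0}, mem_nhdsWithin_of_mem_nhds
      ((continuous_coe c).continuousAt.eventually_ne hcγ), fun g hg => ?_⟩
    have hfing : FiniteMultiplicity (linShift γ) g := by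
      obtain ⟨k, hk⟩ := hg
      rw [hk] at hfin
      exact hfin.mul_left
    obtain ⟨u, hu, huγ⟩ := hfing.exists_eq_pow_mul_and_not_dvd
    rw [linShift_dvd_iff] at huγ
    refine ⟨Multiset.replicate (multiplicity (linShift γ) g) γ, u, by simpa [mul_comm] using hu,
      fun x hx h0 => ?_⟩
    have hne : x ≠ γ := fun h => huγ (h ▸ h0)
    have hfx : f.1 x = 0 :=
      apply_eq_zero_of_dvd ((Dvd.intro_left _ hu.symm).trans hg) h0
    rw [hc] at hfx
    have hx' : c.1 x ≠ 0 := hx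
    simp [linShift, hx', sub_eq_zero, Subtype.coe_inj, hne] at hfx

lemma Momega_eq_span (γ : Set.Icc (0:ℝ) 1) : Momega γ = Ideal.span {linShift γ} := by
  ext f
  rw [Ideal.mem_span_singleton, linShift_dvd_iff]
  rfl

lemma eq_top_of_Momega_le {γ : Set.Icc (0:ℝ) 1} {P : Ideal Comega} {f : Comega}
    (h : Momega γ ≤ P) (hf : f ∈ P) (hfγ : f.1 γ ≠ 0) : P = ⊤ := by
  set c : Comega := ofAnalyticOnNhd (fun _ => f.1 γ) analyticOnNhd_const
  have hc : c ∈ P := by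
    have : f - c ∈ P := h (show f.1 γ - f.1 γ = 0 from sub_self _)
    simpa using P.sub_mem hf this
  exact P.eq_top_of_isUnit_mem hc (isUnit_of_forall_ne_zero_s7 c fun _ => hfγ)

instance : IsPrincipalIdealRing Comega := by
  refine IsPrincipalIdealRing.of_prime fun P hP => ?_
  by_cases hbot : P = ⊥
  · rw [hbot]
    infer_instance
  obtain ⟨f, hfP, hf⟩ := Submodule.exists_mem_ne_zero_of_ne_bot hbot
  obtain ⟨m, u, hu, rfl⟩ := exists_eq_unit_mul_prod_linShift hf
  have hprod := (hP.mem_or_mem hfP).resolve_left fun h => hP.ne_top (P.eq_top_of_isUnit_mem h hu)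
  obtain ⟨_, hmem, hγP⟩ := (hP.multiset_prod_mem_iff_exists_mem _).1 hprod
  obtain ⟨γ, -, rfl⟩ := Multiset.mem_map.1 hmem
  have hle : Momega γ ≤ P := by
    rwa [Momega_eq_span, Ideal.span_singleton_le_iff_mem]
  refine ⟨linShift γ, ?_⟩
  rw [← Ideal.span, ← Momega_eq_span]
  refine le_antisymm (fun g hg => ?_) hle
  by_contra hgγ
  exact hP.ne_top (eq_top_of_Momega_le hle hg hgγ)

end Comega

/-- Every nonzero proper ideal I of C^ω[0,1] is generated by a polynomial with all
roots in [0,1]: there are n ≥ 1 and γ₁, …, γₙ ∈ [0,1] (not necessarily distinct) with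
I = ⟨(x − γ₁)(x − γ₂)⋯(x − γₙ)⟩. -/
theorem ideal_eq_span_prod_linShift (I : Ideal Comega) (hne : I ≠ ⊥) (hpr : I ≠ ⊤) :
    ∃ (n : ℕ) (γ : Fin n → Set.Icc (0:ℝ) 1), 1 ≤ n ∧
      I = Ideal.span {∏ i, linShift (γ i)} := by
  obtain ⟨f, rfl⟩ := IsPrincipalIdealRing.principal I
  rw [← Ideal.span] at hne hpr ⊢
  have hf : f ≠ 0 := fun h => hne (by simp [h])
  obtain ⟨m, u, hu, rfl⟩ := Comega.exists_eq_unit_mul_prod_linShift hf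
  rw [Ideal.span_singleton_mul_left_unit hu] at hpr ⊢
  induction m using Quotient.inductionOn with | _ l => ?_
  refine ⟨l.length, l.get, ?_, ?_⟩
  · rw [Nat.one_le_iff_ne_zero, Ne, List.length_eq_zero_iff]
    rintro rfl
    simp at hpr
  · rw [← List.prod_ofFn]
    simp
end

section
/- Let P be an ideal of C[0,1] that is maximal among ideals disjoint from the multiplicatively closed set of nonzero polynomial functions on [0,1] (such an ideal exists by Zorn's lemma). Then P is a prime ideal of C[0,1] that is not a maximal ideal. -/
/-- The set of nonzero polynomial functions on [0,1]: nonzero restrictions to [0,1] of real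
polynomials.  It is multiplicatively closed and does not contain 0. -/
def polySet : Set C(Set.Icc (0:ℝ) 1, ℝ) :=
  {f | f ≠ 0 ∧ ∃ p : Polynomial ℝ, ∀ x : Set.Icc (0:ℝ) 1, f x = p.eval (x : ℝ)}

theorem one_mem_polySet : (1 : C(Set.Icc (0:ℝ) 1, ℝ)) ∈ polySet :=
  ⟨one_ne_zero, 1, fun _ => by simp⟩

theorem mul_mem_polySet {f g : C(Set.Icc (0:ℝ) 1, ℝ)} (hf : f ∈ polySet) (hg : g ∈ polySet) :
    f * g ∈ polySet := by
  obtain ⟨hf0, p, hp⟩ := hf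
  obtain ⟨hg0, q, hq⟩ := hg
  refine ⟨fun h => ?_, p * q, fun x => by simp [hp, hq]⟩
  have hpq : p * q = 0 := by
    refine Polynomial.eq_zero_of_infinite_isRoot _
      ((Set.Icc_infinite (zero_lt_one' ℝ)).mono fun x hx => ?_)
    have hx0 := DFunLike.congr_fun h ⟨x, hx⟩
    simpa [hp, hq] using hx0
  rcases mul_eq_zero.mp hpq with rfl | rfl
  · exact hf0 (ContinuousMap.ext fun x => by simp [hp])
  · exact hg0 (ContinuousMap.ext fun x => by simp [hq])

/-- Every maximal ideal of `C[0,1]` contains `X - a` for some `a`. -/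
theorem not_disjoint_polySet_of_isMaximal (P : Ideal C(Set.Icc (0:ℝ) 1, ℝ)) [P.IsMaximal] :
    ¬ Disjoint (P : Set C(Set.Icc (0:ℝ) 1, ℝ)) polySet := by
  obtain ⟨a, ha⟩ := ContinuousMap.setOfIdeal_eq_compl_singleton P
  have hP : P = ContinuousMap.idealOfSet ℝ {a}ᶜ :=
    Ideal.IsMaximal.eq_of_le ‹_› (ContinuousMap.idealOf_compl_singleton_isMaximal ℝ a).ne_top
      (ContinuousMap.ideal_gc _ ℝ P _ |>.mp ha.le)
  let f : C(Set.Icc (0:ℝ) 1, ℝ) := ⟨fun x => (x : ℝ) - a, by fun_prop⟩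
  have hfP : f ∈ P := by
    rw [hP, ContinuousMap.mem_idealOfSet_compl_singleton]
    exact sub_self _
  refine Set.not_disjoint_iff.mpr ⟨f, hfP, fun h => ?_, Polynomial.X - Polynomial.C (a : ℝ),
    fun x => by simp [f]⟩
  have h0 : (0 : ℝ) - a = 0 := DFunLike.congr_fun h ⟨0, by simp⟩
  have h1 : (1 : ℝ) - a = 0 := DFunLike.congr_fun h ⟨1, by simp⟩
  linarith

/-- If P is an ideal of C[0,1] maximal among the ideals disjoint from the
multiplicatively closed set of nonzero polynomial functions on [0,1], then P is a prime ideal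
of C[0,1] that is not maximal. -/
theorem prime_not_maximal_of_maximal_disjoint_from_polynomials
    (P : Ideal C(Set.Icc (0:ℝ) 1, ℝ)) (hdisj : Disjoint (P : Set C(Set.Icc (0:ℝ) 1, ℝ)) polySet)
    (hmax : ∀ J : Ideal C(Set.Icc (0:ℝ) 1, ℝ),
      Disjoint (J : Set C(Set.Icc (0:ℝ) 1, ℝ)) polySet → P ≤ J → J = P) :
    P.IsPrime ∧ ¬ P.IsMaximal := by
  refine ⟨?_, fun _ => not_disjoint_polySet_of_isMaximal P hdisj⟩
  let S : Submonoid C(Set.Icc (0:ℝ) 1, ℝ) :=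
    { carrier := polySet
      one_mem' := one_mem_polySet
      mul_mem' := mul_mem_polySet }
  exact Ideal.isPrime_of_maximally_disjoint P S hdisj
    fun J hJ hJS => hJ.ne (hmax J hJS hJ.le).symm
end

section
/- Let P be a prime ideal of C[0,1] that contains no nonzero polynomial function on [0,1]. Then P contains no nonzero real analytic function; that is, the contraction of P to the subring C^ω[0,1] of real analytic functions on [0,1] is the zero ideal. -/
/-- The ring `C^ω[0,1]` of real analytic functions on `[0,1]`, as a subring of the ring
`C[0,1]` of continuous real-valued functions on `[0,1]`. -/
noncomputable def ComegaC : Subring C(Set.Icc (0:ℝ) 1, ℝ) where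
  carrier := {f | IsAnalyticOnIcc ⇑f}
  zero_mem' := by
    intro x
    apply (analyticWithinAt_const (v := (0:ℝ))).congr
    · intro y hy; simp [extIcc, hy]
    · simp [extIcc, x.2]
  one_mem' := by
    intro x
    apply (analyticWithinAt_const (v := (1:ℝ))).congr
    · intro y hy; simp [extIcc, hy]
    · simp [extIcc, x.2]
  add_mem' {f g} hf hg x := by
    rw [show ⇑(f + g) = ⇑f + ⇑g from rfl, extIcc_add]
    exact (hf x).add (hg x)
  mul_mem' {f g} hf hg x := by
    rw [show ⇑(f * g) = ⇑f * ⇑g from rfl, extIcc_mul]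
    exact (hf x).mul (hg x)
  neg_mem' {f} hf x := by
    rw [show ⇑(-f) = -⇑f from rfl, extIcc_neg]
    exact (hf x).neg

open Filter Topology in
/-- Near each point, an analytic function on `[0,1]` either vanishes or is the product of a power
of the local coordinate and a continuous function that does not vanish at the point. -/
lemma IsAnalyticOnIcc.eventually_eq_zero_or_eq_pow_mul {f : Set.Icc (0:ℝ) 1 → ℝ}
    (hf : IsAnalyticOnIcc f) (x : Set.Icc (0:ℝ) 1) :
    (∀ᶠ y in 𝓝 x, f y = 0) ∨
      ∃ (n : ℕ) (g : ℝ → ℝ), ContinuousAt g x ∧ g x ≠ 0 ∧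
        ∀ᶠ y in 𝓝 x, f y = ((y : ℝ) - x) ^ n * g y := by
  obtain ⟨F, hF, hFa⟩ := analyticWithinAt_iff_exists_analyticAt.mp (hf x)
  rw [Set.insert_eq_of_mem x.2] at hF
  have hval : Tendsto (Subtype.val : Set.Icc (0:ℝ) 1 → ℝ) (𝓝 x) (𝓝[Set.Icc 0 1] (x : ℝ)) :=
    tendsto_nhdsWithin_iff.mpr
      ⟨continuous_subtype_val.continuousAt, Eventually.of_forall fun y => y.2⟩
  have hfF : ∀ᶠ y in 𝓝 x, f y = F y := by
    filter_upwards [hval.eventually hF] with y hy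
    simpa [extIcc] using hy
  by_cases h : ∀ᶠ z in 𝓝 (x : ℝ), F z = 0
  · left
    filter_upwards [hfF, continuous_subtype_val.continuousAt.eventually h] with y h₁ h₂
    exact h₁.trans h₂
  · right
    obtain ⟨n, g, hg, hg0, hFg⟩ := hFa.exists_eventuallyEq_pow_smul_nonzero_iff.mpr h
    refine ⟨n, g, hg.continuousAt, hg0, ?_⟩
    filter_upwards [hfF, continuous_subtype_val.continuousAt.eventually hFg] with y h₁ h₂
    simpa using h₁.trans h₂

open Filter Topology in
/-- The identity theorem for analytic functions on `[0,1]`. -/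
lemma IsAnalyticOnIcc.eq_zero_of_eventually_eq_zero {f : Set.Icc (0:ℝ) 1 → ℝ}
    (hf : IsAnalyticOnIcc f) {x : Set.Icc (0:ℝ) 1} (hx : ∀ᶠ y in 𝓝 x, f y = 0) : f = 0 := by
  have hclopen : IsClopen {x | ∀ᶠ y in 𝓝 x, f y = 0} := by
    refine ⟨isClosed_of_closure_subset fun a ha => ?_, isOpen_setOfPred_eventually_nhds⟩
    refine (hf.eventually_eq_zero_or_eq_pow_mul a).resolve_right ?_
    rintro ⟨n, g, hg, hg0, hfg⟩
    have hg' : ∀ᶠ y : Set.Icc (0:ℝ) 1 in 𝓝 a, g y ≠ 0 :=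
      continuous_subtype_val.continuousAt.eventually (hg.eventually_ne hg0)
    obtain ⟨b, hb, hb0⟩ := (mem_closure_iff_frequently.mp ha).and_eventually
      (hfg.and hg').eventually_nhds |>.exists
    have hne : ∀ᶠ y in 𝓝[≠] b, y ≠ a := by
      by_cases hba : b = a
      · subst hba
        exact self_mem_nhdsWithin
      · exact nhdsWithin_le_nhds (eventually_ne_nhds hba)
    obtain ⟨y, hya, hy0, hyfg, hyg⟩ := (hne.and
      ((hb.and hb0).filter_mono nhdsWithin_le_nhds)).exists
    rw [hy0] at hyfg
    exact mul_ne_zero (pow_ne_zero n (sub_ne_zero.mpr (Subtype.coe_ne_coe.mpr hya))) hyg hyfg.symm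
  have huniv := hclopen.eq_univ ⟨x, hx⟩
  funext y
  exact (huniv.symm ▸ Set.mem_univ y : y ∈ {x | ∀ᶠ y in 𝓝 x, f y = 0}).self_of_nhds

open Filter Topology in
/-- A nonzero analytic function on `[0,1]` is, for each point `x`, a power of `y - x` times
a continuous function on `[0,1]` that does not vanish at `x`. -/
lemma IsAnalyticOnIcc.exists_eq_pow_mul {f : C(Set.Icc (0:ℝ) 1, ℝ)}
    (hf : IsAnalyticOnIcc f) (hf0 : f ≠ 0) (x : Set.Icc (0:ℝ) 1) :
    ∃ (n : ℕ) (q : C(Set.Icc (0:ℝ) 1, ℝ)), q x ≠ 0 ∧ ∀ y, f y = ((y : ℝ) - x) ^ n * q y := by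
  obtain h | ⟨n, g, hg, hg0, hfg⟩ := hf.eventually_eq_zero_or_eq_pow_mul x
  · exact absurd (DFunLike.coe_injective (hf.eq_zero_of_eventually_eq_zero h)) hf0
  classical
  let q : Set.Icc (0:ℝ) 1 → ℝ := fun y => if y = x then g x else f y / ((y : ℝ) - x) ^ n
  have hsub {y : Set.Icc (0:ℝ) 1} (hy : y ≠ x) : ((y : ℝ) - x) ^ n ≠ 0 :=
    pow_ne_zero n (sub_ne_zero.mpr (Subtype.coe_ne_coe.mpr hy))
  have hq : Continuous q := by
    refine continuous_iff_continuousAt.mpr fun a => ?_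
    by_cases ha : a = x
    · subst ha
      have hga : ContinuousAt (fun y : Set.Icc (0:ℝ) 1 => g y) a :=
        ContinuousAt.comp (g := g) hg continuous_subtype_val.continuousAt
      refine hga.congr ?_
      filter_upwards [hfg] with y hy
      by_cases hya : y = a
      · simp [q, hya]
      · simp only [q, if_neg hya]
        rw [hy, mul_div_cancel_left₀ _ (hsub hya)]
    · have hfa : ContinuousAt (fun y : Set.Icc (0:ℝ) 1 => f y / ((y : ℝ) - x) ^ n) a :=
        f.continuous.continuousAt.div (by fun_prop) (hsub ha)
      refine hfa.congr ?_
      filter_upwards [eventually_ne_nhds ha] with y hy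
      simp [q, hy]
  refine ⟨n, ⟨q, hq⟩, by simpa [q] using hg0, fun y => ?_⟩
  by_cases hy : y = x
  · subst hy
    simpa [q] using hfg.self_of_nhds
  · simp only [ContinuousMap.coe_mk, q, if_neg hy]
    rw [mul_div_cancel₀ _ (hsub hy)]

/-- A proper ideal of continuous functions on a compact Hausdorff space has a common zero. -/
lemma ContinuousMap.exists_forall_mem_ideal_eq_zero {X : Type*} [TopologicalSpace X]
    [CompactSpace X] [T2Space X] {I : Ideal C(X, ℝ)} (hI : I ≠ ⊤) :
    ∃ x, ∀ f ∈ I, f x = 0 := by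
  obtain ⟨M, hM, hIM⟩ := I.exists_le_maximal hI
  obtain ⟨x, hx⟩ := (ContinuousMap.ideal_isMaximal_iff M).mp hM
  refine ⟨x, fun f hf => ?_⟩
  have hfM := hIM hf
  rw [← hx, ContinuousMap.mem_idealOfSet] at hfM
  exact hfM (by simp)

/-- If P is a prime ideal of C[0,1] containing no nonzero polynomial function
on [0,1], then P contains no nonzero real analytic function: the contraction of P to the
subring C^ω[0,1] of real analytic functions is the zero ideal. -/
theorem contraction_of_prime_eq_bot (P : Ideal C(Set.Icc (0:ℝ) 1, ℝ)) (hP : P.IsPrime)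
    (hdisj : Disjoint (P : Set C(Set.Icc (0:ℝ) 1, ℝ)) polySet) :
    Ideal.comap ComegaC.subtype P = ⊥ := by
  refine eq_bot_iff.mpr fun f hf => ?_
  by_contra hf0
  obtain ⟨x, hx⟩ := ContinuousMap.exists_forall_mem_ideal_eq_zero hP.ne_top
  obtain ⟨n, q, hq, hfq⟩ := IsAnalyticOnIcc.exists_eq_pow_mul f.2
    (fun h => hf0 (Subtype.ext h)) x
  let p : C(Set.Icc (0:ℝ) 1, ℝ) := ⟨fun y => ((y : ℝ) - x) ^ n, by fun_prop⟩
  have hpq : p * q ∈ P := by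
    rw [show p * q = (f : C(Set.Icc (0:ℝ) 1, ℝ)) from ContinuousMap.ext fun y => (hfq y).symm]
    exact hf
  have hp : p ∈ P := (hP.mem_or_mem hpq).resolve_right fun h => hq (hx q h)
  refine Set.disjoint_left.mp hdisj hp ⟨fun hp0 => hf0 (Subtype.ext ?_),
    (Polynomial.X - Polynomial.C (x : ℝ)) ^ n, fun y => by simp [p]⟩
  ext y
  have hpy : ((y : ℝ) - x) ^ n = 0 := DFunLike.congr_fun hp0 y
  simp [hfq y, hpy]
end
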